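/- Let q = p^e be a power of a prime with q ≡ 1 (mod 6), t = (q-1)/6, ω₆ = ω^t, ω₃ = ω^{2t}, ω₂ = ω^{3t}, and let λ ∈ 𝔽_q with λ ≠ 0 and λ⁶ ≠ 1. For the equivalence class of w = (0,0,2,2,4,4): Σ_{w'∈[0,0,2,2,4,4]} N_q(0,w') + S_{[0,0,2,2,4,4]} = −q²·J(ω₆,ω₆)·J(ω₆,ω₃,ω₂)·₃F₂(ω₆,ω₂,ω̄₆; ω₃,ω̄₃ | 1/λ⁶)_q. -/

import Mathlib

open scoped Classical

noncomputable section

/-- The Gauss sum `g(χ) = ∑ₓ χ(x) exp(2π√-1 · tr(x)/p)` of a multiplicative character `χ`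
of a finite field `F` of characteristic `p`, where `tr : F → 𝔽_p` is the trace map. -/
def gaussChar (p : ℕ) (F : Type) [Field F] [Fintype F] [Algebra (ZMod p) F]
    (χ : MulChar F ℂ) : ℂ :=
  ∑ x : F, χ x *
    Complex.exp (2 * Real.pi * Complex.I * ((Algebra.trace (ZMod p) F x).val : ℂ) / (p : ℂ))

/-- The Jacobi sum `J(χ₁, …, χₙ) = ∑_{x₁ + ⋯ + xₙ = 1} χ₁(x₁) ⋯ χₙ(xₙ)`. -/
def jacobiS (F : Type) [Field F] [Fintype F] {n : ℕ} (χ : Fin n → MulChar F ℂ) : ℂ :=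
  ∑ v ∈ Finset.univ.filter (fun v : Fin n → F => ∑ i, v i = 1), ∏ i, χ i (v i)

/-- The normalized Jacobi sum `binom(A; B) = (B(-1)/q) · J(A, B̄)`. -/
def gBinom (F : Type) [Field F] [Fintype F] (A B : MulChar F ℂ) : ℂ :=
  B (-1) / (Fintype.card F : ℂ) * jacobiS F ![A, B⁻¹]

/-- Greene's finite-field hypergeometric function `ₙ₊₁Fₙ` (case `n ≥ 2`), where the sum over all
multiplicative characters is written as a sum over the powers `ω^j`, `0 ≤ j ≤ q - 2`, of a fixed
generator `ω` of the character group. -/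
def greeneF (F : Type) [Field F] [Fintype F] (ω : MulChar F ℂ) {n : ℕ}
    (A : Fin (n + 1) → MulChar F ℂ) (B : Fin n → MulChar F ℂ) (x : F) : ℂ :=
  (Fintype.card F : ℂ) / ((Fintype.card F : ℂ) - 1) *
    ∑ j ∈ Finset.range (Fintype.card F - 1),
      gBinom F (A 0 * ω ^ j) (ω ^ j) *
        (∏ i : Fin n, gBinom F (A i.succ * ω ^ j) (B i * ω ^ j)) * (ω ^ j) x

/-- Greene's finite-field hypergeometric function `₂F₁` (case `n = 1`):
`₂F₁(A₀, A₁; B₁ | x) = ε(x) · (A₁B₁(-1)/q) · ∑_y A₁(y) (A̅₁B₁)(1-y) A̅₀(1-xy)`. -/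
def greene2F1 (F : Type) [Field F] [Fintype F] (A₀ A₁ B₁ : MulChar F ℂ) (x : F) : ℂ :=
  (1 : MulChar F ℂ) x * ((A₁ * B₁) (-1) / (Fintype.card F : ℂ)) *
    ∑ y : F, A₁ y * (A₁⁻¹ * B₁) (1 - y) * A₀⁻¹ (1 - x * y)

/-- The number of `F`-rational points of the Dwork hypersurface
`x₁^d + ⋯ + x_d^d = dλ x₁ ⋯ x_d` in projective space. -/
def dworkCount (F : Type) [Field F] [Fintype F] (d : ℕ) (lam : F) : ℕ :=
  Nat.card {P : Projectivization F (Fin d → F) //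
    ∑ i, P.rep i ^ d = (d : F) * lam * ∏ i, P.rep i}

/-- The number of `F`-rational points of the diagonal hypersurface
`x₁^d + ⋯ + xₙ^d = dλ x₁^{h₁} ⋯ xₙ^{hₙ}` in projective space. -/
def diagCount (F : Type) [Field F] [Fintype F] (d n : ℕ) (h : Fin n → ℕ) (lam : F) : ℕ :=
  Nat.card {P : Projectivization F (Fin n → F) //
    ∑ i, P.rep i ^ d = (d : F) * lam * ∏ i, P.rep i ^ h i}

/-- The quantity `N_q(0, w)` from Koblitz's formula, with `t = (q - 1)/d`. -/
def NqW (p : ℕ) (F : Type) [Field F] [Fintype F] [Algebra (ZMod p) F]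
    (ω : MulChar F ℂ) (d : ℕ) {n : ℕ} (w : Fin n → ZMod d) : ℂ :=
  if ∀ i, w i = 0 then ((Fintype.card F : ℂ) ^ (n - 1) - 1) / ((Fintype.card F : ℂ) - 1)
  else if ∀ i, w i ≠ 0 then
    (1 / (Fintype.card F : ℂ)) *
      ∏ i, gaussChar p F (ω ^ ((w i).val * ((Fintype.card F - 1) / d)))
  else 0

/-- The quantity `S_{[w]} = (q-1)⁻¹ ∑_{j=0}^{q-2} (∏ᵢ g(ω^{wᵢt + hᵢj}) / g(ω^{dj})) ω^{dj}(dλ)`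
from Koblitz's formula, with `t = (q - 1)/d`. -/
def SW (p : ℕ) (F : Type) [Field F] [Fintype F] [Algebra (ZMod p) F]
    (ω : MulChar F ℂ) (d : ℕ) {n : ℕ} (h : Fin n → ℕ) (w : Fin n → ZMod d) (lam : F) : ℂ :=
  ((Fintype.card F : ℂ) - 1)⁻¹ *
    ∑ j ∈ Finset.range (Fintype.card F - 1),
      (∏ i, gaussChar p F (ω ^ ((w i).val * ((Fintype.card F - 1) / d) + h i * j))) /
          gaussChar p F (ω ^ (d * j)) * (ω ^ (d * j)) ((d : F) * lam)

end
noncomputable instance mulCharFintypeInst (F : Type) [Field F] [Fintype F] :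
    Fintype (MulChar F ℂ) := Fintype.ofFinite _

lemma cardF_ne_zero (F : Type) [Field F] [Fintype F] : (Fintype.card F : ℂ) ≠ 0 := by
  exact_mod_cast Fintype.card_ne_zero

lemma cardF_sub_ne_zero (F : Type) [Field F] [Fintype F] : (Fintype.card F : ℂ) - 1 ≠ 0 := by
  rw [sub_ne_zero]
  have : 1 < Fintype.card F := Fintype.one_lt_card
  exact_mod_cast this.ne'

lemma gaussChar_eq (p : ℕ) [Fact p.Prime] (F : Type) [Field F] [Fintype F] [Algebra (ZMod p) F] :
    ∃ ψ : AddChar F ℂ, ψ.IsPrimitive ∧ ∀ χ : MulChar F ℂ, gaussChar p F χ = gaussSum χ ψ := by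
  have : NeZero p := ⟨(Fact.out : p.Prime).ne_zero⟩
  let ψ : AddChar F ℂ := (ZMod.stdAddChar (N := p)).compAddMonoidHom
    (Algebra.trace (ZMod p) F).toAddMonoidHom
  refine ⟨ψ, ?_, ?_⟩
  · apply AddChar.IsPrimitive.of_ne_one
    intro h
    obtain ⟨a, ha⟩ := Algebra.trace_surjective (ZMod p) F 1
    have h1 : ψ a = 1 := by rw [h]; rfl
    have h2 : ZMod.stdAddChar (1 : ZMod p) = 1 := by rw [← ha]; exact h1
    have h3 : (1 : ZMod p) = 0 := ZMod.injective_stdAddChar (by rw [h2, AddChar.map_zero_eq_one])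
    exact one_ne_zero h3
  · intro χ
    unfold gaussChar gaussSum
    refine Finset.sum_congr rfl fun x _ => ?_
    congr 1
    have := ZMod.stdAddChar_coe (N := p) ((Algebra.trace (ZMod p) F x).val : ℤ)
    simp only [Int.cast_natCast, ZMod.natCast_zmod_val] at this
    exact this.symm

section
set_option linter.unusedSectionVars false
variable {F : Type} [Field F] [Fintype F]

lemma mc_negone_sq (χ : MulChar F ℂ) : χ (-1) * χ (-1) = 1 := by
  rw [← map_mul]; simp

lemma gs_one {ψ : AddChar F ℂ} (hψ : ψ.IsPrimitive) : gaussSum (1 : MulChar F ℂ) ψ = -1 := by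
  apply gaussSum_one_left
  intro h
  have := hψ one_ne_zero
  apply this
  subst h
  ext x; simp

lemma gs_mul_inv {ψ : AddChar F ℂ} (hψ : ψ.IsPrimitive) {χ : MulChar F ℂ} (h : χ ≠ 1) :
    gaussSum χ ψ * gaussSum χ⁻¹ ψ = Fintype.card F * χ (-1) := by
  have h1 := gaussSum_mul_gaussSum_eq_card h hψ
  have h2 := mul_gaussSum_inv_eq_gaussSum χ⁻¹ ψ
  have h3 : χ⁻¹ (-1) = χ (-1) := by
    rw [MulChar.inv_apply', inv_neg, inv_one]
  rw [h3] at h2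
  rw [← h2, ← h1]; ring

lemma gs_ne_zero {ψ : AddChar F ℂ} (hψ : ψ.IsPrimitive) (χ : MulChar F ℂ) : gaussSum χ ψ ≠ 0 := by
  by_cases h : χ = 1
  · subst h; rw [gs_one hψ]; norm_num
  · exact gaussSum_ne_zero_of_nontrivial (cardF_ne_zero F) h hψ

lemma gs_norm {ψ : AddChar F ℂ} (hψ : ψ.IsPrimitive) {χ : MulChar F ℂ} (h : χ ≠ 1) :
    ‖gaussSum χ ψ‖ ^ 2 = Fintype.card F := by
  have h1 := gaussSum_mul_gaussSum_eq_card h hψ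
  have h2 := star_gaussSum_eq χ ψ
  rw [← h2] at h1
  have h3 := Complex.mul_conj (gaussSum χ ψ)
  rw [Complex.normSq_eq_norm_sq] at h3
  have : ((‖gaussSum χ ψ‖ ^ 2 : ℝ) : ℂ) = ((Fintype.card F : ℝ) : ℂ) := by
    rw [← h3]; exact_mod_cast h1
  exact_mod_cast this

lemma mc_norm (χ : MulChar F ℂ) {a : F} (ha : a ≠ 0) : ‖χ a‖ = 1 := by
  have h : χ a ^ (Fintype.card F - 1) = 1 := by
    rw [← map_pow, FiniteField.pow_card_sub_one_eq_one a ha, map_one]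
  have hc : 1 < Fintype.card F := Fintype.one_lt_card
  exact Complex.norm_eq_one_of_pow_eq_one h (by omega)

lemma card_mulChar : Fintype.card (MulChar F ℂ) = Fintype.card F - 1 := by
  have h := MulChar.card_eq_card_units_of_hasEnoughRootsOfUnity F ℂ
  rw [Nat.card_eq_fintype_card, Nat.card_eq_fintype_card] at h
  rw [h, Fintype.card_units]

lemma sum_mulChar (a : F) : ∑ χ : MulChar F ℂ, χ a = if a = 1 then (Fintype.card F : ℂ) - 1 else 0 := by
  split_ifs with h
  · subst h
    simp only [map_one, Finset.sum_const, Finset.card_univ, card_mulChar, nsmul_eq_mul, mul_one]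
    rw [Nat.cast_sub Fintype.card_pos]; simp
  · obtain ⟨χ₀, h0⟩ := MulChar.exists_apply_ne_one_of_hasEnoughRootsOfUnity F ℂ h
    have h1 : χ₀ a * ∑ χ : MulChar F ℂ, χ a = ∑ χ : MulChar F ℂ, χ a := by
      rw [Finset.mul_sum]
      exact Fintype.sum_equiv (Equiv.mulLeft χ₀) _ _ (fun χ => by simp)
    have h2 : (χ₀ a - 1) * ∑ χ : MulChar F ℂ, χ a = 0 := by rw [sub_mul, h1]; ring
    exact (mul_eq_zero.mp h2).resolve_left (sub_ne_zero.mpr h0)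

/-- Three-fold Jacobi sum. -/
noncomputable def J3 (A B C : MulChar F ℂ) : ℂ := ∑ x : F, ∑ y : F, A x * B y * C (1 - x - y)

lemma innerS (B C : MulChar F ℂ) {s : F} (hs : s ≠ 0) :
    ∑ y : F, B y * C (s - y) = (B * C) s * jacobiSum B C := by
  rw [jacobiSum, Finset.mul_sum]
  refine (Fintype.sum_equiv (Equiv.mulLeft₀ s hs) _ _ (fun y => ?_)).symm
  have : s - s * y = s * (1 - y) := by ring
  simp only [Equiv.mulLeft₀_apply, this, map_mul, MulChar.mul_apply]; ring

lemma innerS_zero (B C : MulChar F ℂ) :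
    ∑ y : F, B y * C (0 - y) = C (-1) * ∑ y : F, (B * C) y := by
  rw [Finset.mul_sum]
  refine Finset.sum_congr rfl fun y _ => ?_
  rw [zero_sub, neg_eq_neg_one_mul, map_mul, MulChar.mul_apply]; ring

lemma J3_eq_of_ne (A : MulChar F ℂ) {B C : MulChar F ℂ} (h : B * C ≠ 1) :
    J3 A B C = jacobiSum A (B * C) * jacobiSum B C := by
  unfold J3
  conv_rhs => rw [jacobiSum, Finset.sum_mul]
  refine Finset.sum_congr rfl fun x _ => ?_
  simp_rw [mul_assoc]
  rw [← Finset.mul_sum]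
  congr 1
  by_cases hx : 1 - x = 0
  · rw [hx, innerS_zero, MulChar.sum_eq_zero_of_ne_one h, MulChar.map_zero]; simp
  · rw [innerS B C hx]

lemma J3_eq_of_eq (A : MulChar F ℂ) {B C : MulChar F ℂ} (h : B * C = 1) (hB : B ≠ 1) :
    J3 A B C = B (-1) * (Fintype.card F - ∑ x : F, A x) := by
  have hC : C = B⁻¹ := (inv_eq_of_mul_eq_one_right h).symm
  have hC1 : C (-1) = B (-1) := by rw [hC, MulChar.inv_apply', inv_neg, inv_one]
  have key : ∀ x : F, ∑ y : F, A x * B y * C (1 - x - y) =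
      A x * (- B (-1)) + if x = 1 then B (-1) * Fintype.card F else 0 := by
    intro x
    simp_rw [mul_assoc]
    rw [← Finset.mul_sum]
    by_cases hx : x = 1
    · subst hx
      rw [sub_self, innerS_zero, h, MulChar.sum_one_eq_card_units, hC1, Fintype.card_units,
        Nat.cast_sub Fintype.card_pos]
      simp; ring
    · have hx' : 1 - x ≠ 0 := fun h => hx (by linear_combination -h)
      rw [innerS B C hx', h, hC, jacobiSum_nontrivial_inv hB, if_neg hx,
        MulChar.one_apply (isUnit_iff_ne_zero.mpr hx')]
      ring
  unfold J3
  simp_rw [key]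
  rw [Finset.sum_add_distrib, Finset.sum_ite_eq' Finset.univ, ← Finset.sum_mul]
  simp; ring

lemma J3_gauss {ψ : AddChar F ℂ} (hψ : ψ.IsPrimitive) {A B C : MulChar F ℂ} (h : A * B * C ≠ 1)
    (hB : B ≠ 1) :
    gaussSum (A * B * C) ψ * J3 A B C = gaussSum A ψ * gaussSum B ψ * gaussSum C ψ := by
  by_cases hBC : B * C = 1
  · have hA : A ≠ 1 := by rwa [mul_assoc, hBC, mul_one] at h
    have hC : C = B⁻¹ := (inv_eq_of_mul_eq_one_right hBC).symm
    rw [J3_eq_of_eq A hBC hB, MulChar.sum_eq_zero_of_ne_one hA, mul_assoc A, hBC, mul_one,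
      mul_assoc (gaussSum A ψ), hC, gs_mul_inv hψ hB]
    ring
  · rw [J3_eq_of_ne A hBC, mul_assoc A, ← mul_assoc, jacobiSum_mul_nontrivial (by rwa [← mul_assoc]),
      mul_assoc, jacobiSum_mul_nontrivial hBC, mul_assoc]

end
section
set_option linter.unusedSectionVars false
variable {F : Type} [Field F] [Fintype F]

lemma neg_one_of_cube {χ : MulChar F ℂ} (h : χ ^ 3 = 1) : χ (-1) = 1 := by
  have h1 : (χ ^ 3) (-1) = χ (-1) := by
    rw [MulChar.pow_apply' _ (by norm_num), ← map_pow]; norm_num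
  rw [← h1, h]; exact MulChar.one_apply (isUnit_iff_ne_zero.mpr (by simp))

/-- the points on the nodal cubic -/
lemma nodal_points (h3 : (3 : F) ≠ 0) {x y : F} (h : 27 * (x * y * (1 - x - y)) = 1) :
    (x = 1/3 ∧ y = 1/3) ∨ ∃ v : F, v ≠ 0 ∧ v + 1 ≠ 0 ∧ v ^ 2 + v + 1 ≠ 0 ∧
      x = - v ^ 2 / (3 * (v + 1)) ∧ y = (1 + v) ^ 2 / (3 * v) := by
  obtain ⟨X, hX⟩ : ∃ X, X = 3 * x - 1 := ⟨_, rfl⟩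
  obtain ⟨Z, hZ⟩ : ∃ Z, Z = 2 - 3 * x - 3 * y := ⟨_, rfl⟩
  have hx : x = (X + 1) / 3 := by rw [hX]; field_simp; ring
  have hy : y = (1 - X - Z) / 3 := by rw [hX, hZ]; field_simp; ring
  have hE : (X + 1) * (1 - X - Z) * (1 + Z) = 1 := by
    rw [hX, hZ]; linear_combination h
  by_cases hZ0 : Z = 0
  · rw [hZ0] at hE hy
    have : X * X = 0 := by linear_combination -hE
    have hX0 : X = 0 := by simpa using this
    left; rw [hx, hy, hX0]; simp
  · right
    obtain ⟨v, hv⟩ : ∃ v, X = v * Z := ⟨X / Z, by field_simp⟩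
    rw [hv] at hE hx hy
    have hE2 : Z * (v * (v + 1)) = -(v ^ 2 + v + 1) := by
      have : Z ^ 2 * (Z * (v * (v + 1)) + (v ^ 2 + v + 1)) = 0 := by linear_combination -hE
      have := (mul_eq_zero.mp this).resolve_left (pow_ne_zero 2 hZ0)
      linear_combination this
    have hv0 : v ≠ 0 := by rintro rfl; simp at hE2
    have hv1 : v + 1 ≠ 0 := by
      intro h0
      have : v = -1 := by linear_combination h0
      rw [this] at hE2; norm_num at hE2
    have hv2 : v ^ 2 + v + 1 ≠ 0 := by
      intro h0
      rw [h0, neg_zero] at hE2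
      exact (mul_ne_zero hZ0 (mul_ne_zero hv0 hv1)) hE2
    refine ⟨v, hv0, hv1, hv2, ?_, ?_⟩
    · rw [hx]
      field_simp
      linear_combination hE2
    · rw [hy]
      field_simp
      linear_combination -hE2

lemma nodal_card (h3 : (3 : F) ≠ 0) {z : F} (hz : z ^ 2 + z + 1 = 0) :
    ((Finset.univ.filter (fun P : F × F => 27 * (P.1 * P.2 * (1 - P.1 - P.2)) = 1)).card : ℂ)
      = Fintype.card F - 3 := by
  set V : Finset F := Finset.univ \ {0, -1, z, -1 - z} with hV
  set f : F → F × F := fun v => (- v ^ 2 / (3 * (v + 1)), (1 + v) ^ 2 / (3 * v)) with hf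
  have hroots : ∀ v : F, v ^ 2 + v + 1 = 0 ↔ v = z ∨ v = -1 - z := by
    intro v
    constructor
    · intro hv
      have : (v - z) * (v - (-1 - z)) = 0 := by linear_combination hv - hz
      rcases mul_eq_zero.mp this with h | h
      · left; linear_combination h
      · right; linear_combination h
    · rintro (rfl | rfl)
      · exact hz
      · linear_combination hz
  have hVmem : ∀ v, v ∈ V ↔ v ≠ 0 ∧ v + 1 ≠ 0 ∧ v ^ 2 + v + 1 ≠ 0 := by
    intro v
    have e1 : v + 1 = 0 ↔ v = -1 := by
      constructor <;> intro h <;> linear_combination h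
    simp only [hV, ne_eq, hroots, e1, Finset.mem_sdiff, Finset.mem_univ, true_and,
      Finset.mem_insert, Finset.mem_singleton, not_or]
  have hz0 : z ≠ 0 := by rintro rfl; simp at hz
  have hz1 : z ≠ -1 := by rintro rfl; norm_num at hz
  have hz2 : 2 * z + 1 ≠ 0 := by
    intro h
    apply h3
    linear_combination -(2 * z + 1) * h + 4 * hz
  have hVcard : (V.card : ℂ) = Fintype.card F - 4 := by
    have h4 : ({0, -1, z, -1 - z} : Finset F).card = 4 := by
      rw [Finset.card_insert_of_notMem, Finset.card_insert_of_notMem, Finset.card_pair]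
      · intro h; apply hz2; linear_combination h
      · simp only [Finset.mem_insert, Finset.mem_singleton, not_or]
        exact ⟨fun h => hz1 h.symm, fun h => hz0 (by linear_combination h)⟩
      · simp only [Finset.mem_insert, Finset.mem_singleton, not_or]
        refine ⟨fun h => ?_, fun h => hz0 h.symm, fun h => hz1 (by linear_combination h)⟩
        exact one_ne_zero (α := F) (by linear_combination h)
    have h5 : V.card + 4 = Fintype.card F := by
      rw [← h4, hV, Finset.card_sdiff_add_card_eq_card (Finset.subset_univ _), Finset.card_univ]
    rw [← h5]; push_cast; ring
  have hcoord : ∀ v ∈ V, (3 * (f v).1 - 1) = v * (2 - 3 * (f v).1 - 3 * (f v).2) ∧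
      (3 * (f v).1 - 1) ≠ 0 := by
    intro v hv
    obtain ⟨h0, h1, h2⟩ := (hVmem v).mp hv
    have e : 3 * (f v).1 - 1 = -(v ^ 2 + v + 1) / (v + 1) := by
      simp only [hf]; field_simp; ring
    refine ⟨?_, ?_⟩
    · simp only [hf]; field_simp; ring
    · rw [e]; exact div_ne_zero (neg_ne_zero.mpr h2) h1
  have hinj : Set.InjOn f V := by
    intro v hv w hw h
    obtain ⟨a1, b1⟩ := hcoord v hv
    obtain ⟨a2, b2⟩ := hcoord w hw
    rw [h] at a1 b1
    have h5 : (2 - 3 * (f w).1 - 3 * (f w).2) ≠ 0 := by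
      intro h0; rw [h0, mul_zero] at a1; exact b1 a1
    exact mul_right_cancel₀ h5 (a1.symm.trans a2)
  have hset : Finset.univ.filter (fun P : F × F => 27 * (P.1 * P.2 * (1 - P.1 - P.2)) = 1)
      = insert (1/3, 1/3) (V.image f) := by
    ext ⟨x, y⟩
    simp only [Finset.mem_filter, Finset.mem_univ, true_and, Finset.mem_insert, Finset.mem_image]
    constructor
    · intro h
      rcases nodal_points h3 h with ⟨rfl, rfl⟩ | ⟨v, h0, h1, h2, hx, hy⟩
      · left; rfl
      · right; exact ⟨v, (hVmem v).mpr ⟨h0, h1, h2⟩, by rw [hx, hy]⟩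
    · rintro (h | ⟨v, hv, h⟩)
      · obtain ⟨rfl, rfl⟩ := Prod.mk.inj h
        field_simp; ring
      · obtain ⟨h0, h1, h2⟩ := (hVmem v).mp hv
        obtain ⟨rfl, rfl⟩ := Prod.mk.inj h
        field_simp; ring
  rw [hset, Finset.card_insert_of_notMem, Finset.card_image_of_injOn hinj]
  · push_cast; rw [hVcard]; ring
  · intro h
    obtain ⟨v, hv, h⟩ := Finset.mem_image.mp h
    apply (hcoord v hv).2
    rw [h]; field_simp; ring

lemma nodal_char (h3 : (3 : F) ≠ 0) {ω : MulChar F ℂ} (hω : ω ^ 3 = 1) {x y : F}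
    (h : 27 * (x * y * (1 - x - y)) = 1) : ω x * (ω ^ 2) (1 - x - y) = 1 := by
  have hc : ∀ a : F, a ≠ 0 → ω (a ^ 3) = 1 := by
    intro a ha
    rw [map_pow, ← MulChar.pow_apply' _ (by norm_num), hω, MulChar.one_apply
      (isUnit_iff_ne_zero.mpr ha)]
  rw [MulChar.pow_apply' _ (by norm_num), ← map_pow, ← map_mul]
  rcases nodal_points h3 h with ⟨rfl, rfl⟩ | ⟨v, h0, h1, h2, hx, hy⟩
  · have : (1/3 : F) * (1 - 1/3 - 1/3) ^ 2 = (1/3) ^ 3 := by field_simp; ring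
    rw [this]; exact hc _ (by simpa using h3)
  · have : x * (1 - x - y) ^ 2 = (-1 / (3 * (v + 1))) ^ 3 := by
      rw [hx, hy]; field_simp; ring
    rw [this]; exact hc _ (div_ne_zero (by simp) (mul_ne_zero h3 h1))

lemma J3_sum (h3 : (3 : F) ≠ 0) {z : F} (hz : z ^ 2 + z + 1 = 0)
    {ω : MulChar F ℂ} (hω : ω ^ 3 = 1) :
    ∑ χ : MulChar F ℂ, χ 27 * J3 (χ * ω) χ (χ * ω ^ 2)
      = ((Fintype.card F : ℂ) - 1) * (Fintype.card F - 3) := by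
  have h1 : ∀ χ : MulChar F ℂ, χ 27 * J3 (χ * ω) χ (χ * ω ^ 2) =
      ∑ P : F × F, (ω P.1 * (ω ^ 2) (1 - P.1 - P.2)) * χ (27 * (P.1 * P.2 * (1 - P.1 - P.2))) := by
    intro χ
    rw [J3, ← Fintype.sum_prod_type', Finset.mul_sum]
    refine Finset.sum_congr rfl fun P _ => ?_
    simp only [map_mul, MulChar.mul_apply]; ring
  simp_rw [h1]
  rw [Finset.sum_comm]
  simp_rw [← Finset.mul_sum, sum_mulChar, mul_ite, mul_zero]
  rw [← Finset.sum_filter, ← nodal_card h3 hz]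
  rw [Finset.sum_congr rfl (g := fun _ => (Fintype.card F : ℂ) - 1)]
  · rw [Finset.sum_const, nsmul_eq_mul, mul_comm]
  · rintro ⟨x, y⟩ hP
    simp only [Finset.mem_filter, Finset.mem_univ, true_and] at hP
    rw [nodal_char h3 hω hP, one_mul]

lemma J3_cube {ω : MulChar F ℂ} (hω : ω ^ 3 = 1) (hω1 : ω ≠ 1) {χ : MulChar F ℂ}
    (hχ : χ = 1 ∨ χ = ω ∨ χ = ω ^ 2) : J3 (χ * ω) χ (χ * ω ^ 2) = 1 := by
  have hn := neg_one_of_cube hω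
  have hω2 : ω ^ 2 ≠ 1 := by
    intro h; apply hω1; rw [pow_succ, h, one_mul] at hω; exact hω
  have e2 : ω ^ 2 = ω⁻¹ := eq_inv_of_mul_eq_one_left (by rw [← pow_succ]; exact hω)
  have hn2 : (ω ^ 2) (-1) = 1 := neg_one_of_cube (by rw [← pow_mul, mul_comm, pow_mul, hω, one_pow])
  rcases hχ with rfl | rfl | rfl
  · rw [one_mul, one_mul, J3_eq_of_ne _ (by rwa [one_mul]), one_mul,
      jacobiSum_one_nontrivial hω2, e2, jacobiSum_nontrivial_inv hω1, hn]; norm_num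
  · have e3 : χ * χ ^ 2 = 1 := by rw [← hω]; simp only [pow_succ, pow_zero, one_mul]; ac_rfl
    rw [e3, J3_eq_of_ne _ (by rwa [mul_one]), mul_one, jacobiSum_comm χ 1,
      jacobiSum_one_nontrivial hω1, ← pow_two, e2, jacobiSum_comm, jacobiSum_nontrivial_inv hω1, hn]
    norm_num
  · have e3 : ω ^ 2 * ω = 1 := (pow_succ ω 2).symm.trans hω
    have e4 : ω ^ 2 * ω ^ 2 = ω := by
      calc ω ^ 2 * ω ^ 2 = ω ^ 3 * ω := by simp only [pow_succ, pow_zero, one_mul]; ac_rfl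
        _ = ω := by rw [hω, one_mul]
    have e5 : ω ^ 2 * (ω ^ 2 * ω ^ 2) = 1 := by rw [e4, e3]
    rw [e3, e4, J3_eq_of_eq _ e3 hω2, hn2, MulChar.sum_one_eq_card_units, Fintype.card_units,
      Nat.cast_sub Fintype.card_pos]
    simp

lemma unit_sum {ι : Type*} (s : Finset ι) (u : ι → ℂ) (hu : ∀ i ∈ s, ‖u i‖ = 1)
    (hs : ∑ i ∈ s, u i = s.card) : ∀ i ∈ s, u i = 1 := by
  have h1 : ∑ i ∈ s, (1 - (u i).re) = 0 := by
    have := congrArg Complex.re hs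
    rw [Complex.re_sum] at this
    simp [Finset.sum_sub_distrib, this]
  have h2 : ∀ i ∈ s, 0 ≤ 1 - (u i).re := by
    intro i hi
    have := Complex.re_le_norm (u i)
    rw [hu i hi] at this; linarith
  have h3 := (Finset.sum_eq_zero_iff_of_nonneg h2).mp h1
  intro i hi
  have h4 : (u i).re = 1 := by linarith [h3 i hi]
  have h5 := Complex.sq_norm (u i)
  rw [hu i hi, Complex.normSq_apply, h4] at h5
  apply Complex.ext
  · simpa using h4
  · have : (u i).im * (u i).im = 0 := by linarith
    simpa using this

/-- The Hasse-Davenport product formula for the cubic character. -/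
lemma HD3 (h3 : (3 : F) ≠ 0) {z : F} (hz : z ^ 2 + z + 1 = 0)
    {ω : MulChar F ℂ} (hω : ω ^ 3 = 1) (hω1 : ω ≠ 1)
    (hcube : ∀ χ : MulChar F ℂ, χ ^ 3 = 1 → χ = 1 ∨ χ = ω ∨ χ = ω ^ 2)
    {ψ : AddChar F ℂ} (hψ : ψ.IsPrimitive) (χ : MulChar F ℂ) :
    (χ ^ 3) 3 * (gaussSum χ ψ * gaussSum (χ * ω) ψ * gaussSum (χ * ω ^ 2) ψ)
      = Fintype.card F * gaussSum (χ ^ 3) ψ := by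
  have hq := cardF_ne_zero F
  have hω2 : ω ^ 2 ≠ 1 := by
    intro h; apply hω1; rw [pow_succ, h, one_mul] at hω; exact hω
  have e2 : ω ^ 2 = ω⁻¹ := eq_inv_of_mul_eq_one_left (by rw [← pow_succ]; exact hω)
  have hn := neg_one_of_cube hω
  by_cases hχ : χ ^ 3 = 1
  · rw [hχ, MulChar.one_apply (isUnit_iff_ne_zero.mpr h3), gs_one hψ]
    have key : gaussSum ω ψ * gaussSum (ω ^ 2) ψ = Fintype.card F := by
      rw [e2, gs_mul_inv hψ hω1, hn, mul_one]
    have e3 : ω * ω ^ 2 = 1 := by rw [← hω]; simp only [pow_succ, pow_zero, one_mul]; ac_rfl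
    have e3' : ω ^ 2 * ω = 1 := (pow_succ ω 2).symm.trans hω
    have e4 : ω ^ 2 * ω ^ 2 = ω := by
      calc ω ^ 2 * ω ^ 2 = ω ^ 3 * ω := by simp only [pow_succ, pow_zero, one_mul]; ac_rfl
        _ = ω := by rw [hω, one_mul]
    rcases hcube χ hχ with rfl | rfl | rfl
    · rw [one_mul, one_mul, one_mul, gs_one hψ]; linear_combination -key
    · rw [e3, ← pow_two, gs_one hψ]; linear_combination -key
    · rw [e3', e4, gs_one hψ]; linear_combination -key
  · have hne : ∀ χ : MulChar F ℂ, χ ^ 3 ≠ 1 → χ ≠ 1 ∧ χ * ω ≠ 1 ∧ χ * ω ^ 2 ≠ 1 := by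
      intro χ h
      refine ⟨fun h' => h (by rw [h', one_pow]), fun h' => h ?_, fun h' => h ?_⟩
      · have : (χ * ω) ^ 3 = 1 := by rw [h', one_pow]
        rwa [mul_pow, hω, mul_one] at this
      · have : (χ * ω ^ 2) ^ 3 = 1 := by rw [h', one_pow]
        rwa [mul_pow, ← pow_mul, mul_comm 2 3, pow_mul, hω, one_pow, mul_one] at this
    have hprod : ∀ χ : MulChar F ℂ, χ * ω * χ * (χ * ω ^ 2) = χ ^ 3 := by
      intro χ
      calc χ * ω * χ * (χ * ω ^ 2) = χ ^ 3 * ω ^ 3 := by simp only [pow_succ, pow_zero, one_mul]; ac_rfl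
        _ = χ ^ 3 := by rw [hω, mul_one]
    have hJ : ∀ χ : MulChar F ℂ, χ ^ 3 ≠ 1 → gaussSum (χ ^ 3) ψ * J3 (χ * ω) χ (χ * ω ^ 2) =
        gaussSum (χ * ω) ψ * gaussSum χ ψ * gaussSum (χ * ω ^ 2) ψ := by
      intro χ h
      have := J3_gauss hψ (A := χ * ω) (B := χ) (C := χ * ω ^ 2) (by rwa [hprod]) (hne χ h).1
      rwa [hprod] at this
    have h27 : ∀ χ : MulChar F ℂ, χ 27 = (χ ^ 3) 3 := by
      intro χ
      rw [MulChar.pow_apply' _ (by norm_num), ← map_pow]; norm_num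
    set s : Finset (MulChar F ℂ) := Finset.univ.filter (fun χ => ¬ χ ^ 3 = 1) with hs
    set s' : Finset (MulChar F ℂ) := Finset.univ.filter (fun χ => χ ^ 3 = 1) with hs'
    have hs'eq : s' = {1, ω, ω ^ 2} := by
      ext χ
      simp only [hs', Finset.mem_filter, Finset.mem_univ, true_and, Finset.mem_insert,
        Finset.mem_singleton]
      refine ⟨hcube χ, ?_⟩
      rintro (rfl | rfl | rfl)
      · exact one_pow _
      · exact hω
      · rw [← pow_mul, mul_comm, pow_mul, hω, one_pow]
    have hs'card : s'.card = 3 := by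
      rw [hs'eq, Finset.card_insert_of_notMem, Finset.card_pair]
      · intro h; apply hω1
        rw [pow_two] at h; exact (left_eq_mul.mp h)
      · simp only [Finset.mem_insert, Finset.mem_singleton, not_or]
        exact ⟨fun h => hω1 h.symm, fun h => hω2 h.symm⟩
    have hscard : (s.card : ℂ) = Fintype.card F - 4 := by
      have h1 := Finset.card_filter_add_card_filter_not (s := (Finset.univ : Finset (MulChar F ℂ)))
        (fun χ => χ ^ 3 = 1)
      rw [← hs, ← hs', hs'card, Finset.card_univ, card_mulChar] at h1
      have h2 : Fintype.card F = s.card + 4 := by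
        have := Fintype.card_pos (α := F); omega
      rw [h2]; push_cast; ring
    have hsplit := J3_sum h3 hz hω
    rw [← Finset.sum_filter_add_sum_filter_not Finset.univ (fun χ : MulChar F ℂ => χ ^ 3 = 1),
      ← hs, ← hs'] at hsplit
    have h0 : ∑ χ ∈ s', χ 27 * J3 (χ * ω) χ (χ * ω ^ 2) = 3 := by
      rw [Finset.sum_congr rfl (g := fun _ => (1 : ℂ))]
      · simp [hs'card]
      · intro χ h
        have h' : χ ^ 3 = 1 := by simpa [hs'] using h
        rw [J3_cube hω hω1 (hcube χ h'), h27, h', MulChar.one_apply (isUnit_iff_ne_zero.mpr h3),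
          mul_one]
    rw [h0] at hsplit
    have hu := unit_sum s (fun χ => χ 27 * J3 (χ * ω) χ (χ * ω ^ 2) / Fintype.card F) ?_ ?_ χ
      (by simpa [hs] using hχ)
    · rw [div_eq_one_iff_eq hq, h27] at hu
      have := hJ χ hχ
      linear_combination (gaussSum (χ ^ 3) ψ) * hu - (χ ^ 3) 3 * this
    · intro χ h
      have h' : χ ^ 3 ≠ 1 := by simpa [hs] using h
      have h1 := congrArg (fun w => ‖w‖ ^ 2) (hJ χ h')
      simp only [norm_mul, mul_pow] at h1
      obtain ⟨n1, n2, n3⟩ := hne χ h'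
      rw [gs_norm hψ h', gs_norm hψ n1, gs_norm hψ n2, gs_norm hψ n3] at h1
      have hq' : (0 : ℝ) < Fintype.card F := by exact_mod_cast Fintype.card_pos
      have h27' : (27 : F) ≠ 0 := by
        have : (27 : F) = 3 ^ 3 := by norm_num
        rw [this]; exact pow_ne_zero 3 h3
      rw [norm_div, norm_mul, mc_norm χ h27', one_mul, Complex.norm_natCast, div_eq_one_iff_eq hq'.ne']
      have h2 : ‖J3 (χ * ω) χ (χ * ω ^ 2)‖ ^ 2 = (Fintype.card F : ℝ) ^ 2 := by
        apply mul_left_cancel₀ hq'.ne'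
        rw [h1]; ring
      exact (pow_left_inj₀ (norm_nonneg _) hq'.le (by norm_num)).mp h2
    · rw [← Finset.sum_div, hscard, div_eq_iff hq]
      linear_combination hsplit

/-- The Hasse-Davenport product formula for the quadratic character. -/
lemma HD2 (h2 : (2 : F) ≠ 0) {ρ : MulChar F ℂ} (hρ : ρ ^ 2 = 1) (hρ1 : ρ ≠ 1)
    (hsq : ∀ χ : MulChar F ℂ, χ ^ 2 = 1 → χ = 1 ∨ χ = ρ)
    {ψ : AddChar F ℂ} (hψ : ψ.IsPrimitive) (χ : MulChar F ℂ) :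
    (χ ^ 2) 2 * (gaussSum χ ψ * gaussSum (χ * ρ) ψ) = gaussSum (χ ^ 2) ψ * gaussSum ρ ψ := by
  by_cases hχ : χ ^ 2 = 1
  · rw [hχ, MulChar.one_apply (isUnit_iff_ne_zero.mpr h2), gs_one hψ]
    rcases hsq χ hχ with rfl | rfl
    · rw [gs_one hψ, one_mul, one_mul]
    · rw [← pow_two, hρ, gs_one hψ]; ring
  · have hχ1 : χ ≠ 1 := fun h => hχ (by rw [h, one_pow])
    have hχρ : χ * ρ ≠ 1 := fun h => hχ (by
      have : (χ * ρ) ^ 2 = 1 := by rw [h, one_pow]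
      rwa [mul_pow, hρ, mul_one] at this)
    have h4 : (χ ^ 2) 2 = χ 4 := by
      rw [MulChar.pow_apply' _ (by norm_num), ← map_pow]; norm_num
    have h40 : (4 : F) ≠ 0 := by
      have : (4 : F) = 2 ^ 2 := by norm_num
      rw [this]; exact pow_ne_zero 2 h2
    have hchar : ringChar F ≠ 2 := by
      intro h
      apply h2
      have := CharP.cast_eq_zero F (ringChar F)
      rw [h] at this; exact_mod_cast this
    have hquad : (quadraticChar F).ringHomComp (Int.castRingHom ℂ) = ρ := by
      have hq2 : (quadraticChar F).ringHomComp (Int.castRingHom ℂ) ^ 2 = 1 := by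
        rw [MulChar.ringHomComp_pow, (quadraticChar_isQuadratic F).sq_eq_one,
          MulChar.ringHomComp_one]
      rcases hsq _ hq2 with h | h
      · exfalso
        exact (MulChar.ringHomComp_ne_one_iff (RingHom.injective_int _)).mpr
          (quadraticChar_ne_one hchar) h
      · exact h
    -- count
    have hcount : ∀ a : F, (∑ x : F, if x ^ 2 = a then (1 : ℂ) else 0) = 1 + ρ a := by
      intro a
      have h := quadraticChar_card_sqrts hchar a
      have e : ρ a = ((quadraticChar F a : ℤ) : ℂ) := by rw [← hquad]; rfl
      rw [e]
      have h' : (({x : F | x ^ 2 = a}.toFinset.card : ℤ) : ℂ) = ((quadraticChar F a : ℤ) : ℂ) + 1 := by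
        rw [h]; push_cast; rfl
      rw [add_comm, ← h', Finset.sum_boole]
      push_cast
      congr 2
      ext x; simp
    have hJ : χ 4 * jacobiSum χ χ = jacobiSum χ ρ := by
      rw [jacobiSum, Finset.mul_sum]
      have e1 : ∑ x : F, χ 4 * (χ x * χ (1 - x)) = ∑ y : F, χ (1 - y ^ 2) := by
        let e : F ≃ F := (Equiv.mulLeft₀ 2 h2).trans (Equiv.subRight 1)
        refine Fintype.sum_equiv e _ _ (fun x => ?_)
        rw [← map_mul, ← map_mul]
        congr 1
        simp only [e, Equiv.trans_apply, Equiv.mulLeft₀_apply, Equiv.subRight_apply]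
        ring
      have e2 : ∑ y : F, χ (1 - y ^ 2) = ∑ a : F, χ (1 - a) * (1 + ρ a) := by
        simp_rw [← hcount, Finset.mul_sum]
        rw [Finset.sum_comm]
        refine Finset.sum_congr rfl fun y _ => ?_
        simp
      have e3 : ∑ a : F, χ (1 - a) = 0 := by
        rw [← MulChar.sum_eq_zero_of_ne_one hχ1]
        exact Fintype.sum_equiv (Equiv.subLeft 1) _ _ (fun x => rfl)
      rw [e1, e2, jacobiSum_comm]
      simp_rw [mul_add, mul_one]
      rw [Finset.sum_add_distrib, e3, zero_add, jacobiSum]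
      exact Finset.sum_congr rfl fun x _ => mul_comm _ _
    have j1 := jacobiSum_mul_nontrivial (χ := χ) (φ := χ) (by rwa [← pow_two]) ψ
    have j2 := jacobiSum_mul_nontrivial (χ := χ) (φ := ρ) hχρ ψ
    rw [← pow_two χ] at j1
    rw [← hJ] at j2
    rw [h4]
    apply mul_left_cancel₀ (gs_ne_zero hψ χ)
    linear_combination (-χ 4 * gaussSum (χ * ρ) ψ) * j1 + gaussSum (χ ^ 2) ψ * j2
end
section
set_option linter.unusedSectionVars false
variable {F : Type} [Field F] [Fintype F]

lemma jacobiS_two (A B : MulChar F ℂ) : jacobiS F ![A, B] = jacobiSum A B := by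
  unfold jacobiS jacobiSum
  refine Finset.sum_bij' (fun v _ => v 0) (fun x _ => ![x, 1 - x]) ?_ ?_ ?_ ?_ ?_
  · intro v _; exact Finset.mem_univ _
  · intro x _; simp
  · intro v hv
    simp only [Finset.mem_filter, Finset.mem_univ, true_and, Fin.sum_univ_two] at hv
    ext i; fin_cases i
    · rfl
    · simp; linear_combination -hv
  · intro x _; rfl
  · intro v hv
    simp only [Finset.mem_filter, Finset.mem_univ, true_and, Fin.sum_univ_two] at hv
    rw [Fin.prod_univ_two]
    have : 1 - v 0 = v 1 := by linear_combination -hv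
    rw [this]; rfl

lemma jacobiS_three (A B C : MulChar F ℂ) : jacobiS F ![A, B, C] = J3 A B C := by
  unfold jacobiS J3
  rw [← Fintype.sum_prod_type']
  refine Finset.sum_bij' (fun v _ => (v 0, v 1)) (fun x _ => ![x.1, x.2, 1 - x.1 - x.2]) ?_ ?_ ?_ ?_ ?_
  · intro v _; exact Finset.mem_univ _
  · intro x _; simp [Fin.sum_univ_three]
  · intro v hv
    simp only [Finset.mem_filter, Finset.mem_univ, true_and, Fin.sum_univ_three] at hv
    ext i; fin_cases i
    · rfl
    · rfl
    · simp; linear_combination -hv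
  · intro x _; rfl
  · intro v hv
    simp only [Finset.mem_filter, Finset.mem_univ, true_and, Fin.sum_univ_three] at hv
    rw [Fin.prod_univ_three]
    have : 1 - v 0 - v 1 = v 2 := by linear_combination -hv
    rw [this]; rfl

lemma inv_negone (χ : MulChar F ℂ) : χ⁻¹ (-1) = χ (-1) := by
  rw [MulChar.inv_apply', inv_neg, inv_one]

lemma cube_negone (χ : MulChar F ℂ) : (χ ^ 3) (-1) = χ (-1) := by
  rw [MulChar.pow_apply' _ (by norm_num), ← map_pow]; norm_num

/-- the common summand of both sides -/
noncomputable def Gterm (ψ : AddChar F ℂ) (ρ : MulChar F ℂ) (lam : F) (χ : MulChar F ℂ) : ℂ :=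
  Fintype.card F * gaussSum ρ ψ * (ρ (-1) * χ (-1)) * gaussSum (χ ^ 3) ψ *
    gaussSum ((χ ^ 3)⁻¹ * ρ) ψ * (χ ^ 6) lam

lemma Tterm_eq (h2 : (2 : F) ≠ 0) (h3 : (3 : F) ≠ 0) {z : F} (hz : z ^ 2 + z + 1 = 0)
    {ω ρ : MulChar F ℂ} (hω : ω ^ 3 = 1) (hω1 : ω ≠ 1)
    (hcube : ∀ χ : MulChar F ℂ, χ ^ 3 = 1 → χ = 1 ∨ χ = ω ∨ χ = ω ^ 2)
    (hρ : ρ ^ 2 = 1) (hρ1 : ρ ≠ 1)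
    (hsq : ∀ χ : MulChar F ℂ, χ ^ 2 = 1 → χ = 1 ∨ χ = ρ)
    {ψ : AddChar F ℂ} (hψ : ψ.IsPrimitive) {lam : F} (hlam : lam ≠ 0) (χ : MulChar F ℂ) :
    gaussSum χ ψ ^ 2 * gaussSum (χ * ω) ψ ^ 2 * gaussSum (χ * ω ^ 2) ψ ^ 2
      / gaussSum (χ ^ 6) ψ * (χ ^ 6) (6 * lam) = Gterm ψ ρ lam χ -
      if χ ^ 3 = ρ then (Fintype.card F : ℂ) ^ 2 * (Fintype.card F - 1) * ρ (-1) else 0 := by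
  have hd3 := HD3 h3 hz hω hω1 hcube hψ χ
  have hd2 := HD2 h2 hρ hρ1 hsq hψ (χ ^ 3)
  rw [← pow_mul] at hd2
  norm_num only at hd2
  have h63 : (χ ^ 6) 3 = (χ ^ 3) 3 ^ 2 := by
    rw [← MulChar.pow_apply' _ (by norm_num), ← pow_mul]
  have h6 : (χ ^ 6) (6 * lam) = (χ ^ 6) 2 * (χ ^ 3) 3 ^ 2 * (χ ^ 6) lam := by
    rw [← h63, ← map_mul, ← map_mul]; norm_num
  have hρi : ρ⁻¹ = ρ := inv_eq_of_mul_eq_one_left (by rw [← pow_two, hρ])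
  have hρρ := gs_mul_inv hψ hρ1
  rw [hρi] at hρρ
  have e1 := mc_negone_sq ρ
  have e2 := mc_negone_sq χ
  have g6 := gs_ne_zero hψ (χ ^ 6)
  have hT : gaussSum χ ψ ^ 2 * gaussSum (χ * ω) ψ ^ 2 * gaussSum (χ * ω ^ 2) ψ ^ 2
      / gaussSum (χ ^ 6) ψ * (χ ^ 6) (6 * lam) =
      (Fintype.card F * gaussSum (χ ^ 3) ψ) ^ 2 * (χ ^ 6) 2 * (χ ^ 6) lam / gaussSum (χ ^ 6) ψ := by
    rw [h6, ← hd3]; ring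
  rw [hT]
  by_cases hc : χ ^ 3 = ρ
  · have hx6 : χ ^ 6 = 1 := by
      rw [← hρ, ← hc, ← pow_mul]
    have hxn : χ (-1) = ρ (-1) := by rw [← hc, cube_negone]
    rw [if_pos hc, Gterm, hc, hx6, hρi, ← pow_two, hρ, gs_one hψ, hxn,
      MulChar.one_apply (isUnit_iff_ne_zero.mpr hlam), MulChar.one_apply (isUnit_iff_ne_zero.mpr h2)]
    rw [e1]
    linear_combination (-(Fintype.card F : ℂ) ^ 2 + Fintype.card F) * hρρ
  · have hcne : χ ^ 3 * ρ ≠ 1 := fun h => hc (by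
      rw [eq_inv_of_mul_eq_one_left h, hρi])
    rw [if_neg hc, sub_zero, Gterm, div_eq_iff g6]
    have hb := gs_mul_inv hψ hcne
    rw [mul_inv, hρi, MulChar.mul_apply, cube_negone] at hb
    linear_combination (-(Fintype.card F : ℂ) * gaussSum (χ ^ 3) ψ *
      gaussSum ((χ ^ 3)⁻¹ * ρ) ψ * (ρ (-1) * χ (-1)) * (χ ^ 6) lam) * (-hd2)
      - (Fintype.card F : ℂ) * gaussSum (χ ^ 3) ψ ^ 2 * (ρ (-1) * χ (-1)) * (χ ^ 6) lam * (χ ^ 6) 2 * hb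
      - (Fintype.card F : ℂ) ^ 2 * gaussSum (χ ^ 3) ψ ^ 2 * (χ ^ 6) lam * (χ ^ 6) 2 *
        (χ (-1) * χ (-1) * e1 + e2)

lemma gBinom_eq {ψ : AddChar F ℂ} {A B θ : MulChar F ℂ} (hθ : θ ≠ 1)
    (h : A * B⁻¹ = θ) :
    gaussSum θ ψ * (Fintype.card F * gBinom F A B) = B (-1) * (gaussSum A ψ * gaussSum B⁻¹ ψ) := by
  have := jacobiSum_mul_nontrivial (χ := A) (φ := B⁻¹) (by rwa [h]) ψ
  rw [h] at this
  rw [gBinom, jacobiS_two, ← this]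
  have hq := cardF_ne_zero F
  field_simp

lemma Rterm_eq (h3 : (3 : F) ≠ 0) {z : F} (hz : z ^ 2 + z + 1 = 0)
    {θ : MulChar F ℂ} (hθ6 : θ ^ 6 = 1) (hθ2 : θ ^ 2 ≠ 1) (hθ3 : θ ^ 3 ≠ 1)
    (hcube : ∀ χ : MulChar F ℂ, χ ^ 3 = 1 → χ = 1 ∨ χ = θ ^ 2 ∨ χ = (θ ^ 2) ^ 2)
    {ψ : AddChar F ℂ} (hψ : ψ.IsPrimitive) {lam : F} (χ : MulChar F ℂ) :
    -((Fintype.card F : ℂ) ^ 2) * jacobiS F ![θ, θ] * jacobiS F ![θ, θ ^ 2, θ ^ 3] *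
      (Fintype.card F * (gBinom F (θ * χ) χ * (gBinom F (θ ^ 3 * χ) (θ ^ 2 * χ) *
        gBinom F (θ⁻¹ * χ) ((θ ^ 2)⁻¹ * χ)) * χ (lam ^ 6)⁻¹)) = Gterm ψ (θ ^ 3) lam χ⁻¹ := by
  have hθ1 : θ ≠ 1 := fun h => hθ2 (by rw [h, one_pow])
  have hq := cardF_ne_zero F
  have hω : (θ ^ 2) ^ 3 = 1 := by rw [← pow_mul]; exact hθ6
  have hρ : (θ ^ 3) ^ 2 = 1 := by rw [← pow_mul]; exact hθ6
  have hρi : (θ ^ 3)⁻¹ = θ ^ 3 := inv_eq_of_mul_eq_one_left (by rw [← pow_two, hρ])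
  have i1 : θ⁻¹ = θ ^ 5 := inv_eq_of_mul_eq_one_left (by rw [← pow_succ]; exact hθ6)
  have i2 : (θ ^ 2)⁻¹ = θ ^ 4 := inv_eq_of_mul_eq_one_left (by rw [← pow_add]; exact hθ6)
  have i4 : (θ ^ 4)⁻¹ = θ ^ 2 := inv_eq_of_mul_eq_one_left (by rw [← pow_add]; exact hθ6)
  -- the Jacobi sums
  have j1 := jacobiSum_mul_nontrivial (χ := θ) (φ := θ) (by rwa [← pow_two]) ψ
  rw [← pow_two θ] at j1
  have hθ5 : θ ^ 2 * θ ^ 3 = θ⁻¹ := by rw [i1, ← pow_add]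
  have hθi : θ⁻¹ ≠ 1 := inv_ne_one.mpr hθ1
  have j2 := jacobiSum_mul_nontrivial (χ := θ ^ 2) (φ := θ ^ 3) (by rwa [hθ5]) ψ
  have j3 : J3 θ (θ ^ 2) (θ ^ 3) = - θ (-1) * jacobiSum (θ ^ 2) (θ ^ 3) := by
    rw [J3_eq_of_ne _ (by rwa [hθ5]), hθ5, jacobiSum_nontrivial_inv hθ1]
  rw [hθ5] at j2
  have j4 := gs_mul_inv hψ hθ1
  have jj : Fintype.card F * J3 θ (θ ^ 2) (θ ^ 3) =
      - (gaussSum θ ψ * gaussSum (θ ^ 2) ψ * gaussSum (θ ^ 3) ψ) := by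
    rw [j3]
    linear_combination (- gaussSum θ ψ) * j2 + jacobiSum (θ ^ 2) (θ ^ 3) * j4
  -- the binomials
  have b1 := gBinom_eq (ψ := ψ) (A := θ * χ) (B := χ) hθ1 (by rw [mul_assoc, mul_inv_cancel, mul_one])
  have b2 := gBinom_eq (ψ := ψ) (A := θ ^ 3 * χ) (B := θ ^ 2 * χ) hθ1 (by
    rw [mul_inv, i2, mul_mul_mul_comm, mul_inv_cancel, mul_one, ← pow_add]
    show θ ^ (6 + 1) = θ
    rw [pow_succ, hθ6, one_mul])
  have b3 := gBinom_eq (ψ := ψ) (A := θ⁻¹ * χ) (B := (θ ^ 2)⁻¹ * χ) hθ1 (by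
    rw [mul_inv, inv_inv, mul_mul_mul_comm, mul_inv_cancel, mul_one, pow_two, inv_mul_cancel_left])
  -- Hasse-Davenport
  have d1 := HD3 h3 hz hω hθ2 hcube hψ χ⁻¹
  have d2 := HD3 h3 hz hω hθ2 hcube hψ (χ * θ ^ 3)
  have c1 : ((θ ^ 2) * χ)⁻¹ = χ⁻¹ * (θ ^ 2) ^ 2 := by
    rw [mul_inv, i2, ← pow_mul, mul_comm]
  have c2 : ((θ ^ 2)⁻¹ * χ)⁻¹ = χ⁻¹ * θ ^ 2 := by
    rw [mul_inv, inv_inv, mul_comm]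
  have c3 : χ * θ ^ 3 * θ ^ 2 = θ⁻¹ * χ := by
    rw [i1, mul_assoc, ← pow_add, mul_comm]
  have c4 : χ * θ ^ 3 * (θ ^ 2) ^ 2 = θ * χ := by
    rw [← pow_mul, mul_assoc, ← pow_add, mul_comm]
    congr 1
    show θ ^ (6 + 1) = θ
    rw [pow_succ, hθ6, one_mul]
  have c5 : (χ * θ ^ 3) ^ 3 = χ ^ 3 * θ ^ 3 := by
    rw [mul_pow, pow_succ (θ ^ 3), hρ, one_mul]
  rw [c3, c4, c5, mul_comm χ (θ ^ 3), MulChar.mul_apply] at d2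
  rw [c1] at b2
  rw [c2] at b3
  have c6 : ((χ⁻¹ ^ 3)⁻¹ * θ ^ 3) = χ ^ 3 * θ ^ 3 := by rw [inv_pow, inv_inv]
  have s1 : ((θ ^ 2) * χ) (-1) = χ (-1) := by
    rw [MulChar.mul_apply, neg_one_of_cube hω, one_mul]
  have s2 : ((θ ^ 2)⁻¹ * χ) (-1) = χ (-1) := by
    rw [MulChar.mul_apply, inv_negone, neg_one_of_cube hω, one_mul]
  rw [s1] at b2
  rw [s2] at b3
  have s3 : (χ⁻¹ ^ 3) 3 * (χ ^ 3) 3 = 1 := by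
    rw [← MulChar.mul_apply, inv_pow, inv_mul_cancel, MulChar.one_apply (isUnit_iff_ne_zero.mpr h3)]
  have s4 : (θ ^ 3) 3 = (θ ^ 3) (-1) := by
    have hw : (2 * z + 1) ^ 2 = -1 * 3 := by linear_combination 4 * hz
    have hw0 : 2 * z + 1 ≠ 0 := by
      intro h; rw [h] at hw; apply h3; linear_combination hw
    have : (θ ^ 3) ((2 * z + 1) ^ 2) = 1 := by
      rw [map_pow, ← MulChar.pow_apply' _ (by norm_num), hρ,
        MulChar.one_apply (isUnit_iff_ne_zero.mpr hw0)]
    rw [hw, map_mul] at this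
    linear_combination (θ ^ 3) (-1) * this - (θ ^ 3) 3 * mc_negone_sq (θ ^ 3)
  have s5 : χ (lam ^ 6)⁻¹ = (χ⁻¹ ^ 6) lam := by
    rw [MulChar.pow_apply' _ (by norm_num), MulChar.inv_apply', ← map_pow, inv_pow]
  have e1 := mc_negone_sq (θ ^ 3)
  have e2 := mc_negone_sq χ
  have g1 := gs_ne_zero hψ θ
  have g2 := gs_ne_zero hψ (θ ^ 2)
  rw [jacobiS_two, jacobiS_three, s5, Gterm, c6, inv_negone]
  rw [s4] at d2
  -- abstract everything
  generalize gBinom F (θ * χ) χ = B1 at *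
  generalize gBinom F (θ ^ 3 * χ) (θ ^ 2 * χ) = B2 at *
  generalize gBinom F (θ⁻¹ * χ) ((θ ^ 2)⁻¹ * χ) = B3 at *
  generalize J3 θ (θ ^ 2) (θ ^ 3) = JJ at *
  generalize jacobiSum θ θ = J1 at *
  generalize (Fintype.card F : ℂ) = Q at *
  generalize gaussSum (χ⁻¹ * θ ^ 2) ψ = u2 at *
  generalize gaussSum (χ⁻¹ * (θ ^ 2) ^ 2) ψ = u4 at *
  generalize gaussSum χ⁻¹ ψ = u0 at *
  generalize gaussSum (θ * χ) ψ = v1 at *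
  generalize gaussSum (θ ^ 3 * χ) ψ = v3 at *
  generalize gaussSum (θ⁻¹ * χ) ψ = v5 at *
  generalize gaussSum (χ ^ 3 * θ ^ 3) ψ = m at *
  generalize gaussSum (χ⁻¹ ^ 3) ψ = n at *
  generalize gaussSum (θ ^ 3) ψ = r at *
  generalize gaussSum (θ ^ 2) ψ = h at *
  generalize gaussSum θ ψ = g at *
  generalize (χ⁻¹ ^ 3) 3 = k' at *
  generalize (χ ^ 3) 3 = k at *
  generalize (θ ^ 3) (-1) = e at *
  generalize χ (-1) = c at *
  generalize (χ⁻¹ ^ 6) lam = L at *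
  have B : g ^ 3 * (Q ^ 3 * (B1 * B2 * B3)) = c ^ 3 * (v1 * u0 * v3 * u4 * v5 * u2) := by
    calc g ^ 3 * (Q ^ 3 * (B1 * B2 * B3)) = (g * (Q * B1)) * (g * (Q * B2)) * (g * (Q * B3)) := by ring
      _ = _ := by rw [b1, b2, b3]; ring
  have D : (k' * k) * e * (v1 * u0 * v3 * u4 * v5 * u2) = Q ^ 2 * (n * m) := by
    calc (k' * k) * e * (v1 * u0 * v3 * u4 * v5 * u2)
        = (k' * (u0 * u2 * u4)) * (k * e * (v3 * v5 * v1)) := by ring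
      _ = _ := by rw [d1, d2]; ring
  rw [s3, one_mul] at D
  have hc3 : c ^ 3 = c := by linear_combination c * e2
  rw [hc3] at B
  have D' : v1 * u0 * v3 * u4 * v5 * u2 = e * (Q ^ 2 * (n * m)) := by
    rw [← D]; linear_combination (-(v1 * u0 * v3 * u4 * v5 * u2)) * e1
  rw [D'] at B
  apply mul_left_cancel₀ (mul_ne_zero (mul_ne_zero hq g2) hq)
  calc Q * h * Q * (-(Q ^ 2) * J1 * JJ * (Q * (B1 * (B2 * B3) * L)))
      = - Q * (h * J1) * (Q * JJ) * (Q ^ 3 * (B1 * B2 * B3)) * L := by ring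
    _ = Q * h * r * (g ^ 3 * (Q ^ 3 * (B1 * B2 * B3))) * L := by rw [j1, jj]; ring
    _ = _ := by rw [B]; ring

lemma sum_gen_pow {ω : MulChar F ℂ} (hω : ∀ χ : MulChar F ℂ, ∃ j : ℕ, χ = ω ^ j)
    (f : MulChar F ℂ → ℂ) :
    ∑ j ∈ Finset.range (Fintype.card F - 1), f (ω ^ j) = ∑ χ : MulChar F ℂ, f χ := by
  have ho : orderOf ω = Fintype.card F - 1 := by
    rw [← card_mulChar, ← Nat.card_eq_fintype_card]
    apply orderOf_eq_card_of_forall_mem_zpowers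
    intro χ
    obtain ⟨j, rfl⟩ := hω χ
    exact Subgroup.npow_mem_zpowers ω j
  refine Finset.sum_bij (fun j _ => ω ^ j) (fun _ _ => Finset.mem_univ _) ?_ ?_ (fun _ _ => rfl)
  · intro i hi j hj h
    rw [Finset.mem_range, ← ho] at hi hj
    exact pow_injOn_Iio_orderOf hi hj h
  · intro χ _
    obtain ⟨j, rfl⟩ := hω χ
    have hc : 1 < Fintype.card F := Fintype.one_lt_card
    refine ⟨j % orderOf ω, ?_, pow_mod_orderOf _ _⟩
    rw [Finset.mem_range, ← ho]
    exact Nat.mod_lt _ (by omega)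

lemma orderOf_gen {ω : MulChar F ℂ} (hω : ∀ χ : MulChar F ℂ, ∃ j : ℕ, χ = ω ^ j) :
    orderOf ω = Fintype.card F - 1 := by
  rw [← card_mulChar, ← Nat.card_eq_fintype_card]
  apply orderOf_eq_card_of_forall_mem_zpowers
  intro χ
  obtain ⟨j, rfl⟩ := hω χ
  exact Subgroup.npow_mem_zpowers ω j

end

section
variable {F : Type} [Field F] [Fintype F]

lemma count_cube {θ : MulChar F ℂ} (hθ6 : θ ^ 6 = 1) (hθ2 : θ ^ 2 ≠ 1)
    (hcube : ∀ χ : MulChar F ℂ, χ ^ 3 = 1 → χ = 1 ∨ χ = θ ^ 2 ∨ χ = (θ ^ 2) ^ 2) (c : ℂ) :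
    ∑ χ : MulChar F ℂ, (if χ ^ 3 = θ ^ 3 then c else 0) = 3 * c := by
  have hset : (Finset.univ.filter (fun χ : MulChar F ℂ => χ ^ 3 = θ ^ 3)) =
      {θ, θ * θ ^ 2, θ * (θ ^ 2) ^ 2} := by
    ext χ
    simp only [Finset.mem_filter, Finset.mem_univ, true_and, Finset.mem_insert,
      Finset.mem_singleton]
    constructor
    · intro h
      have h1 : (θ⁻¹ * χ) ^ 3 = 1 := by rw [mul_pow, h, ← mul_pow, inv_mul_cancel, one_pow]
      rcases hcube _ h1 with h | h | h
      · left; rw [inv_mul_eq_iff_eq_mul] at h; rw [h, mul_one]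
      · right; left; rw [inv_mul_eq_iff_eq_mul] at h; exact h
      · right; right; rw [inv_mul_eq_iff_eq_mul] at h; exact h
    · have e2 : (θ ^ 2) ^ 3 = 1 := by rw [← pow_mul]; exact hθ6
      rintro (h | h | h)
      · rw [h]
      · rw [h, mul_pow, e2, mul_one]
      · rw [h, mul_pow, ← pow_mul (θ ^ 2), mul_comm 2 3, pow_mul (θ ^ 2), e2, one_pow, mul_one]
  have n1 : θ ≠ θ * θ ^ 2 := by
    intro h; exact hθ2 (left_eq_mul.mp h)
  have h4 : (θ ^ 2) ^ 2 ≠ 1 := by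
    intro h
    apply hθ2
    have : (θ ^ 2) ^ 3 = 1 := by rw [← pow_mul]; exact hθ6
    rw [pow_succ, h, one_mul] at this; exact this
  have n2 : θ ≠ θ * (θ ^ 2) ^ 2 := by
    intro h; exact h4 (left_eq_mul.mp h)
  have n3 : θ * θ ^ 2 ≠ θ * (θ ^ 2) ^ 2 := by
    intro h
    have := mul_left_cancel h
    rw [pow_two (θ ^ 2)] at this
    exact hθ2 (left_eq_mul.mp this)
  rw [← Finset.sum_filter, Finset.sum_const, hset, Finset.card_insert_of_notMem,
    Finset.card_insert_of_notMem, Finset.card_singleton]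
  · rw [nsmul_eq_mul]; norm_num
  · simpa using n3
  · simp only [Finset.mem_insert, Finset.mem_singleton, not_or]; exact ⟨n1, n2⟩

lemma exists_cube_root {t : ℕ} (hc : Fintype.card F = 6 * t + 1) :
    ∃ z : F, z ^ 2 + z + 1 = 0 := by
  have : Fact (Nat.Prime 3) := ⟨by norm_num⟩
  obtain ⟨u, hu⟩ := exists_prime_orderOf_dvd_card (G := Fˣ) 3 (by
    rw [Fintype.card_units, hc]; exact ⟨2 * t, by omega⟩)
  refine ⟨u, ?_⟩
  have h3 : (u : F) ^ 3 = 1 := by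
    have := pow_orderOf_eq_one u
    rw [hu] at this; rw [← Units.val_pow_eq_pow_val, this, Units.val_one]
  have h1 : (u : F) - 1 ≠ 0 := by
    rw [sub_ne_zero]; intro h
    have : u = 1 := by ext; simpa using h
    rw [this, orderOf_one] at hu; omega
  apply mul_left_cancel₀ h1
  linear_combination h3

lemma char_ne {t : ℕ} (hc : Fintype.card F = 6 * t + 1) : (2 : F) ≠ 0 ∧ (3 : F) ≠ 0 := by
  have h0 : ((6 * t + 1 : ℕ) : F) = 0 := by rw [← hc]; exact FiniteField.cast_card_eq_zero F
  push_cast at h0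
  constructor
  · intro h
    apply one_ne_zero (α := F)
    linear_combination h0 - 3 * t * h
  · intro h
    apply one_ne_zero (α := F)
    linear_combination h0 - 2 * t * h

lemma gen_facts {t : ℕ} (hc : Fintype.card F = 6 * t + 1) {ω : MulChar F ℂ}
    (hω : ∀ χ : MulChar F ℂ, ∃ j : ℕ, χ = ω ^ j) :
    (ω ^ t) ^ 6 = 1 ∧ (ω ^ t) ^ 2 ≠ 1 ∧ (ω ^ t) ^ 3 ≠ 1 ∧
    (∀ χ : MulChar F ℂ, χ ^ 3 = 1 → χ = 1 ∨ χ = (ω ^ t) ^ 2 ∨ χ = ((ω ^ t) ^ 2) ^ 2) ∧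
    (∀ χ : MulChar F ℂ, χ ^ 2 = 1 → χ = 1 ∨ χ = (ω ^ t) ^ 3) := by
  have hcc : 1 < Fintype.card F := Fintype.one_lt_card
  have ht : 0 < t := by omega
  have ho := orderOf_gen hω
  rw [hc, Nat.add_sub_cancel] at ho
  have h6 : (ω ^ t) ^ 6 = 1 := by
    rw [← pow_mul, mul_comm, ← ho, pow_orderOf_eq_one]
  refine ⟨h6, ?_, ?_, ?_, ?_⟩
  · intro h
    rw [← pow_mul] at h
    have := Nat.le_of_dvd (by omega) (orderOf_dvd_of_pow_eq_one h)
    omega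
  · intro h
    rw [← pow_mul] at h
    have := Nat.le_of_dvd (by omega) (orderOf_dvd_of_pow_eq_one h)
    omega
  · intro χ h
    obtain ⟨j, rfl⟩ := hω χ
    rw [← pow_mul] at h
    obtain ⟨k, hk⟩ := orderOf_dvd_of_pow_eq_one h
    rw [ho] at hk
    have hj : j = t * 2 * k := by
      have : j * 3 = (t * 2 * k) * 3 := by rw [hk]; ring
      omega
    have e3 : ((ω ^ t) ^ 2) ^ 3 = 1 := by rw [← pow_mul]; exact h6
    rw [hj, pow_mul, pow_mul, pow_eq_pow_mod k e3]
    have : k % 3 < 3 := Nat.mod_lt _ (by norm_num)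
    interval_cases k % 3
    · left; rw [pow_zero]
    · right; left; rw [pow_one]
    · right; right; rfl
  · intro χ h
    obtain ⟨j, rfl⟩ := hω χ
    rw [← pow_mul] at h
    obtain ⟨k, hk⟩ := orderOf_dvd_of_pow_eq_one h
    rw [ho] at hk
    have hj : j = t * 3 * k := by
      have : j * 2 = (t * 3 * k) * 2 := by rw [hk]; ring
      omega
    have e3 : ((ω ^ t) ^ 3) ^ 2 = 1 := by rw [← pow_mul]; exact h6
    rw [hj, pow_mul, pow_mul, pow_eq_pow_mod k e3]
    have : k % 2 < 2 := Nat.mod_lt _ (by norm_num)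
    interval_cases k % 2
    · left; rw [pow_zero]
    · right; rw [pow_one]

lemma NqW_sum (p : ℕ) [Algebra (ZMod p) F] {t : ℕ} (hc : Fintype.card F = 6 * t + 1)
    {ω : MulChar F ℂ} (h6 : (ω ^ t) ^ 6 = 1) (h2 : (ω ^ t) ^ 2 ≠ 1) (h3 : (ω ^ t) ^ 3 ≠ 1)
    {ψ : AddChar F ℂ} (hψ : ψ.IsPrimitive)
    (hg : ∀ χ : MulChar F ℂ, gaussChar p F χ = gaussSum χ ψ) :
    (∑ k ∈ Finset.range 6, NqW p F ω 6
      (fun i => (![0,0,2,2,4,4] : Fin 6 → ZMod 6) i + (k : ZMod 6))) =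
      3 * ((Fintype.card F : ℂ) ^ 2 * ((ω ^ t) ^ 3) (-1)) := by
  have hq := cardF_ne_zero F
  have htt : (Fintype.card F - 1) / 6 = t := by omega
  have even : ∀ k : ℕ, (k = 0 ∨ k = 2 ∨ k = 4) → NqW p F ω 6
      (fun i => (![0,0,2,2,4,4] : Fin 6 → ZMod 6) i + (k : ZMod 6)) = 0 := by
    intro k hk
    unfold NqW
    rw [if_neg, if_neg]
    · rcases hk with rfl | rfl | rfl <;> decide
    · rcases hk with rfl | rfl | rfl <;> decide
  have hθ1 : ω ^ t ≠ 1 := fun h => h2 (by rw [h, one_pow])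
  have e5 : (ω ^ t) ^ 5 = (ω ^ t)⁻¹ := by
    rw [eq_inv_iff_mul_eq_one, ← pow_succ]; exact h6
  have a1 := gs_mul_inv hψ hθ1
  have a3 := gs_mul_inv hψ h3
  have i3 : ((ω ^ t) ^ 3)⁻¹ = (ω ^ t) ^ 3 := by
    rw [inv_eq_iff_mul_eq_one, ← pow_add]; exact h6
  rw [i3] at a3
  have s1 := mc_negone_sq (ω ^ t)
  have key : 1 / (Fintype.card F : ℂ) * (gaussSum (ω ^ t) ψ ^ 2 * gaussSum ((ω ^ t) ^ 3) ψ ^ 2 *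
      gaussSum ((ω ^ t) ^ 5) ψ ^ 2) = (Fintype.card F : ℂ) ^ 2 * ((ω ^ t) ^ 3) (-1) := by
    rw [e5]
    field_simp
    linear_combination (gaussSum ((ω ^ t) ^ 3) ψ ^ 2) *
      (gaussSum (ω ^ t) ψ * gaussSum (ω ^ t)⁻¹ ψ + (Fintype.card F) * (ω ^ t) (-1)) * a1
      + (Fintype.card F : ℂ) ^ 2 * (ω ^ t) (-1) ^ 2 * a3
      + (Fintype.card F : ℂ) ^ 3 * ((ω ^ t) ^ 3) (-1) * s1
  have odd : ∀ k : ℕ, (k = 1 ∨ k = 3 ∨ k = 5) → NqW p F ω 6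
      (fun i => (![0,0,2,2,4,4] : Fin 6 → ZMod 6) i + (k : ZMod 6)) =
        (Fintype.card F : ℂ) ^ 2 * ((ω ^ t) ^ 3) (-1) := by
    intro k hk
    rw [← key]
    unfold NqW
    rw [if_neg, if_pos, htt]
    · simp only [hg, Fin.prod_univ_six, mul_comm _ t, pow_mul]
      rcases hk with rfl | rfl | rfl
      · have v0 : ((![0,0,2,2,4,4] : Fin 6 → ZMod 6) 0 + ((1 : ℕ) : ZMod 6)).val = 1 := by decide
        have v1 : ((![0,0,2,2,4,4] : Fin 6 → ZMod 6) 1 + ((1 : ℕ) : ZMod 6)).val = 1 := by decide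
        have v2 : ((![0,0,2,2,4,4] : Fin 6 → ZMod 6) 2 + ((1 : ℕ) : ZMod 6)).val = 3 := by decide
        have v3 : ((![0,0,2,2,4,4] : Fin 6 → ZMod 6) 3 + ((1 : ℕ) : ZMod 6)).val = 3 := by decide
        have v4 : ((![0,0,2,2,4,4] : Fin 6 → ZMod 6) 4 + ((1 : ℕ) : ZMod 6)).val = 5 := by decide
        have v5 : ((![0,0,2,2,4,4] : Fin 6 → ZMod 6) 5 + ((1 : ℕ) : ZMod 6)).val = 5 := by decide
        rw [v0, v1, v2, v3, v4, v5, pow_one]; ring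
      · have v0 : ((![0,0,2,2,4,4] : Fin 6 → ZMod 6) 0 + ((3 : ℕ) : ZMod 6)).val = 3 := by decide
        have v1 : ((![0,0,2,2,4,4] : Fin 6 → ZMod 6) 1 + ((3 : ℕ) : ZMod 6)).val = 3 := by decide
        have v2 : ((![0,0,2,2,4,4] : Fin 6 → ZMod 6) 2 + ((3 : ℕ) : ZMod 6)).val = 5 := by decide
        have v3 : ((![0,0,2,2,4,4] : Fin 6 → ZMod 6) 3 + ((3 : ℕ) : ZMod 6)).val = 5 := by decide
        have v4 : ((![0,0,2,2,4,4] : Fin 6 → ZMod 6) 4 + ((3 : ℕ) : ZMod 6)).val = 1 := by decide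
        have v5 : ((![0,0,2,2,4,4] : Fin 6 → ZMod 6) 5 + ((3 : ℕ) : ZMod 6)).val = 1 := by decide
        rw [v0, v1, v2, v3, v4, v5, pow_one]; ring
      · have v0 : ((![0,0,2,2,4,4] : Fin 6 → ZMod 6) 0 + ((5 : ℕ) : ZMod 6)).val = 5 := by decide
        have v1 : ((![0,0,2,2,4,4] : Fin 6 → ZMod 6) 1 + ((5 : ℕ) : ZMod 6)).val = 5 := by decide
        have v2 : ((![0,0,2,2,4,4] : Fin 6 → ZMod 6) 2 + ((5 : ℕ) : ZMod 6)).val = 1 := by decide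
        have v3 : ((![0,0,2,2,4,4] : Fin 6 → ZMod 6) 3 + ((5 : ℕ) : ZMod 6)).val = 1 := by decide
        have v4 : ((![0,0,2,2,4,4] : Fin 6 → ZMod 6) 4 + ((5 : ℕ) : ZMod 6)).val = 3 := by decide
        have v5 : ((![0,0,2,2,4,4] : Fin 6 → ZMod 6) 5 + ((5 : ℕ) : ZMod 6)).val = 3 := by decide
        rw [v0, v1, v2, v3, v4, v5, pow_one]; ring
    · rcases hk with rfl | rfl | rfl <;> decide
    · rcases hk with rfl | rfl | rfl <;> decide
  rw [Finset.sum_range_succ, Finset.sum_range_succ, Finset.sum_range_succ, Finset.sum_range_succ,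
    Finset.sum_range_succ, Finset.sum_range_succ, Finset.sum_range_zero,
    even 0 (by simp), even 2 (by simp), even 4 (by simp),
    odd 1 (by simp), odd 3 (by simp), odd 5 (by simp)]
  ring

lemma SW_eq (p : ℕ) [Algebra (ZMod p) F] {t : ℕ} (hc : Fintype.card F = 6 * t + 1)
    {ω : MulChar F ℂ} (hω : ∀ χ : MulChar F ℂ, ∃ j : ℕ, χ = ω ^ j)
    {ψ : AddChar F ℂ} (hψ : ψ.IsPrimitive)
    (hg : ∀ χ : MulChar F ℂ, gaussChar p F χ = gaussSum χ ψ) {lam : F} (hlam : lam ≠ 0) :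
    SW p F ω 6 (fun _ => 1) (![0,0,2,2,4,4] : Fin 6 → ZMod 6) lam =
      ((Fintype.card F : ℂ) - 1)⁻¹ * (∑ χ, Gterm ψ ((ω ^ t) ^ 3) lam χ -
        3 * ((Fintype.card F : ℂ) ^ 2 * (Fintype.card F - 1) * ((ω ^ t) ^ 3) (-1))) := by
  obtain ⟨h6, h2, h3, hcube, hsq⟩ := gen_facts hc hω
  obtain ⟨c2, c3⟩ := char_ne hc
  obtain ⟨z, hz⟩ := exists_cube_root hc
  have htt : (Fintype.card F - 1) / 6 = t := by omega
  have v0 : ((![0,0,2,2,4,4] : Fin 6 → ZMod 6) 0).val = 0 := by decide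
  have v1 : ((![0,0,2,2,4,4] : Fin 6 → ZMod 6) 1).val = 0 := by decide
  have v2 : ((![0,0,2,2,4,4] : Fin 6 → ZMod 6) 2).val = 2 := by decide
  have v3 : ((![0,0,2,2,4,4] : Fin 6 → ZMod 6) 3).val = 2 := by decide
  have v4 : ((![0,0,2,2,4,4] : Fin 6 → ZMod 6) 4).val = 4 := by decide
  have v5 : ((![0,0,2,2,4,4] : Fin 6 → ZMod 6) 5).val = 4 := by decide
  unfold SW
  rw [htt, ← count_cube h6 h2 hcube, ← Finset.sum_sub_distrib, ← sum_gen_pow hω]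
  congr 1
  refine Finset.sum_congr rfl fun j _ => ?_
  rw [← Tterm_eq c2 c3 hz (by rw [← pow_mul]; exact h6) h2 hcube (by rw [← pow_mul]; exact h6) h3
    hsq hψ hlam (ω ^ j)]
  have w0 : ω ^ (0 * t + 1 * j) = ω ^ j := by rw [zero_mul, zero_add, one_mul]
  have w2 : ω ^ (2 * t + 1 * j) = ω ^ j * (ω ^ t) ^ 2 := by
    rw [← pow_mul, ← pow_add]; congr 1; ring
  have w4 : ω ^ (4 * t + 1 * j) = ω ^ j * ((ω ^ t) ^ 2) ^ 2 := by
    rw [← pow_mul, ← pow_mul, ← pow_add]; congr 1; ring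
  have w6 : ω ^ (6 * j) = (ω ^ j) ^ 6 := by rw [← pow_mul, mul_comm]
  simp only [hg, Fin.prod_univ_six]
  rw [v0, v1, v2, v3, v4, v5, w0, w2, w4, w6]
  push_cast
  ring

lemma RHS_eq {t : ℕ} (hc : Fintype.card F = 6 * t + 1)
    {ω : MulChar F ℂ} (hω : ∀ χ : MulChar F ℂ, ∃ j : ℕ, χ = ω ^ j)
    {ψ : AddChar F ℂ} (hψ : ψ.IsPrimitive) (lam : F) :
    -((Fintype.card F : ℂ) ^ 2) * jacobiS F ![ω ^ t, ω ^ t] *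
      jacobiS F ![ω ^ t, (ω ^ t) ^ 2, (ω ^ t) ^ 3] *
        greeneF F ω ![ω ^ t, (ω ^ t) ^ 3, (ω ^ t)⁻¹] ![(ω ^ t) ^ 2, ((ω ^ t) ^ 2)⁻¹] (lam ^ 6)⁻¹ =
      ((Fintype.card F : ℂ) - 1)⁻¹ * ∑ χ, Gterm ψ ((ω ^ t) ^ 3) lam χ := by
  obtain ⟨h6, h2, h3, hcube, hsq⟩ := gen_facts hc hω
  obtain ⟨c2, c3⟩ := char_ne hc
  obtain ⟨z, hz⟩ := exists_cube_root hc
  have hinv : ∑ χ, Gterm ψ ((ω ^ t) ^ 3) lam χ = ∑ χ, Gterm ψ ((ω ^ t) ^ 3) lam χ⁻¹ :=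
    (Equiv.sum_comp (Equiv.inv (MulChar F ℂ)) (fun χ => Gterm ψ ((ω ^ t) ^ 3) lam χ)).symm
  rw [hinv, ← sum_gen_pow hω]
  have : ∀ j ∈ Finset.range (Fintype.card F - 1), Gterm ψ ((ω ^ t) ^ 3) lam (ω ^ j)⁻¹ = _ :=
    fun j _ => (Rterm_eq c3 hz h6 h2 h3 hcube hψ (ω ^ j)).symm
  rw [Finset.sum_congr rfl this, ← Finset.mul_sum, ← Finset.mul_sum]
  unfold greeneF
  simp only [Fin.prod_univ_two]
  simp only [Fin.succ_zero_eq_one, Fin.succ_one_eq_two, Matrix.cons_val_zero, Matrix.cons_val_one,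
    Matrix.cons_val]
  ring

end


/-- The contribution of the class of `w = (0,0,2,2,4,4)` in Koblitz's formula. -/
theorem class_002244 (p e q t : ℕ) [Fact p.Prime] (F : Type) [Field F] [Fintype F]
    [Algebra (ZMod p) F]
    (he : 0 < e) (hq : q = Fintype.card F) (hqe : q = p ^ e) (hmod : q % 6 = 1)
    (ht : t = (q - 1) / 6)
    (ω : MulChar F ℂ) (hω : ∀ χ : MulChar F ℂ, ∃ j : ℕ, χ = ω ^ j)
    (ω₆ ω₃ ω₂ : MulChar F ℂ)
    (hω₆ : ω₆ = ω ^ t) (hω₃ : ω₃ = ω ^ (2 * t)) (hω₂ : ω₂ = ω ^ (3 * t))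
    (lam : F) (hlam : lam ≠ 0) (hlam6 : lam ^ 6 ≠ 1) :
    (∑ k ∈ Finset.range 6, NqW p F ω 6 (fun i => (![0,0,2,2,4,4] : Fin 6 → ZMod 6) i + (k : ZMod 6))) +
      SW p F ω 6 (fun _ => 1) (![0,0,2,2,4,4] : Fin 6 → ZMod 6) lam =
      -((q : ℂ) ^ 2) * jacobiS F ![ω₆, ω₆] * jacobiS F ![ω₆, ω₃, ω₂] *
        greeneF F ω ![ω₆, ω₂, ω₆⁻¹] ![ω₃, ω₃⁻¹] (lam ^ 6)⁻¹ := by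
  subst hq
  have hc : Fintype.card F = 6 * t + 1 := by omega
  have e3 : ω ^ (2 * t) = (ω ^ t) ^ 2 := by rw [← pow_mul, mul_comm]
  have e2 : ω ^ (3 * t) = (ω ^ t) ^ 3 := by rw [← pow_mul, mul_comm]
  rw [e3] at hω₃
  rw [e2] at hω₂
  subst hω₆ hω₃ hω₂
  obtain ⟨ψ, hψ, hg⟩ := gaussChar_eq p F
  obtain ⟨h6, h2, h3, -, -⟩ := gen_facts hc hω
  rw [NqW_sum p hc h6 h2 h3 hψ hg, SW_eq p hc hω hψ hg hlam, RHS_eq hc hω hψ lam]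
  have := cardF_sub_ne_zero F
  field_simp
  ring
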